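/- arXiv:2010.15571 — 5 statements merged into one kernel-verified Lean document; each statement's English description precedes it below -/
import Mathlib

section
/- Let d, D ≥ 1 and X = [0,1]^d. Let P ⊆ B(X,ℝ^D) be the set of all bounded functions admitting a representation, and let cl(P) denote the closure of P in B(X,ℝ^D) with respect to the uniform norm. Then C(X,ℝ^D), the set of continuous functions X → ℝ^D, is a closed subset of cl(P) that is nowhere dense in cl(P): the only open subset of cl(P) contained in C(X,ℝ^D) is the empty set. -/
open scoped ENNReal

/-- The cube `[0,1]^d` in `ℝ^d`. -/
def cube (d : ℕ) : Set (EuclideanSpace ℝ (Fin d)) :=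
  {x | ∀ i, x i ∈ Set.Icc (0:ℝ) 1}

/-- `B(X, ℝ^D)`: the Banach space of bounded functions from the cube `[0,1]^d` to `ℝ^D`
equipped with the uniform norm, realized as `lp _ ∞`. -/
noncomputable abbrev BddFun (d D : ℕ) :=
  lp (fun _ : cube d => EuclideanSpace ℝ (Fin D)) ∞

/-- The subset of `B(X,ℝ^D)` of functions admitting a representation
`f = ∑ n, f_n · 1_{K_n}` with `f_n` continuous and `K_n ⊆ X` nonempty compact. -/
def PRep (d D : ℕ) : Set (BddFun d D) :=
  {F | ∃ N : ℕ, 0 < N ∧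
    ∃ (fs : Fin N → cube d → EuclideanSpace ℝ (Fin D)) (Ks : Fin N → Set (cube d)),
      (∀ n, Continuous (fs n)) ∧
      (∀ n, (Ks n).Nonempty ∧ IsCompact (Ks n)) ∧
      ∀ x : cube d, (F : ∀ _ : cube d, EuclideanSpace ℝ (Fin D)) x
        = ∑ n, (Ks n).indicator (fs n) x}

/-- The subset of `B(X,ℝ^D)` consisting of continuous functions `C(X,ℝ^D)`. -/
def ContFun (d D : ℕ) : Set (BddFun d D) :=
  {F | Continuous fun x : cube d => (F : ∀ _ : cube d, EuclideanSpace ℝ (Fin D)) x}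

open Filter Topology

theorem convex_cube (d : ℕ) : Convex ℝ (cube d) := by
  intro x hx y hy a b ha hb hab i
  exact convex_Icc (0 : ℝ) 1 (hx i) (hy i) ha hb hab

theorem isCompact_cube (d : ℕ) : IsCompact (cube d) := by
  have h : cube d = (EuclideanSpace.equiv (Fin d) ℝ).toHomeomorph ⁻¹'
      (Set.univ.pi fun _ => Set.Icc (0 : ℝ) 1) := by
    ext x
    simp [cube, Pi.le_def, forall_and]
  rw [h, Homeomorph.isCompact_preimage]
  exact isCompact_univ_pi fun _ => isCompact_Icc

instance compactSpace_cube (d : ℕ) : CompactSpace (cube d) :=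
  isCompact_iff_compactSpace.mp (isCompact_cube d)

instance preconnectedSpace_cube (d : ℕ) : PreconnectedSpace (cube d) :=
  Subtype.preconnectedSpace (convex_cube d).isPreconnected

/-- The origin, as a point of the cube. -/
def cubeZero (d : ℕ) : cube d := ⟨0, fun _ => by simp⟩

theorem nontrivial_cube {d : ℕ} (hd : 0 < d) : Nontrivial (cube d) := by
  refine ⟨cubeZero d, ⟨WithLp.toLp 2 fun _ => 1, fun _ => by simp⟩, fun h => ?_⟩
  have h_eval := congrArg (fun x : cube d => (x : EuclideanSpace ℝ (Fin d)) ⟨0, hd⟩) h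
  simp [cubeZero] at h_eval

/-- On a nontrivial connected T₁ space, a function supported at one point is discontinuous. -/
theorem not_continuous_piSingle {α E : Type*} [TopologicalSpace α] [T1Space α]
    [PreconnectedSpace α] [Nontrivial α] [DecidableEq α] [TopologicalSpace E] [T1Space E]
    [Zero E] (a : α) {v : E} (hv : v ≠ 0) :
    ¬ Continuous (Pi.single a v : α → E) := by
  intro h
  have hpre : (Pi.single a v : α → E) ⁻¹' {0}ᶜ = {a} := by
    ext x
    by_cases hx : x = a
    · subst hx
      simp [hv]
    · simp [hx]
  have hopen : IsOpen ({a} : Set α) := hpre ▸ isOpen_compl_singleton.preimage h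
  have huniv := IsClopen.eq_univ ⟨isClosed_singleton, hopen⟩ (Set.singleton_nonempty a)
  obtain ⟨b, hb⟩ := exists_ne a
  exact hb (huniv.symm ▸ Set.mem_univ b : b ∈ ({a} : Set α))

theorem isClosed_contFun (d D : ℕ) : IsClosed (ContFun d D) := by
  refine isClosed_of_closure_subset fun F hF => ?_
  refine continuous_of_uniform_approx_of_continuous fun u hu => ?_
  obtain ⟨ε, hε, hεu⟩ := Metric.mem_uniformity_dist.mp hu
  obtain ⟨G, hG, hFG⟩ := Metric.mem_closure_iff.mp hF ε hε
  refine ⟨_, hG, fun x => hεu ?_⟩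
  rw [dist_eq_norm] at hFG ⊢
  exact (lp.norm_apply_le_norm ENNReal.top_ne_zero (F - G) x).trans_lt hFG

open scoped Classical in
/-- A continuous function changed at one point of the cube has a representation. -/
theorem add_single_mem_PRep {d D : ℕ} {G : BddFun d D} (hG : G ∈ ContFun d D) (a : cube d)
    (v : EuclideanSpace ℝ (Fin D)) : G + lp.single ∞ a v ∈ PRep d D := by
  refine ⟨2, two_pos, ![fun x => G x, fun _ => v], ![Set.univ, {a}], ?_, ?_, fun x => ?_⟩
  · rw [Fin.forall_fin_two]
    exact ⟨hG, continuous_const⟩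
  · rw [Fin.forall_fin_two]
    exact ⟨⟨⟨a, trivial⟩, isCompact_univ⟩, Set.singleton_nonempty a, isCompact_singleton⟩
  · by_cases hx : x = a
    · subst hx
      simp [Fin.sum_univ_two]
    · simp [Fin.sum_univ_two, hx]

theorem contFun_subset_PRep (d D : ℕ) : ContFun d D ⊆ PRep d D := by
  classical
  intro G hG
  simpa using add_single_mem_PRep hG (cubeZero d) 0

open scoped Classical in
theorem add_single_notMem_contFun {d D : ℕ} (hd : 0 < d) {G : BddFun d D}
    (hG : G ∈ ContFun d D) (a : cube d) {v : EuclideanSpace ℝ (Fin D)} (hv : v ≠ 0) :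
    G + lp.single ∞ a v ∉ ContFun d D := by
  intro h
  have := nontrivial_cube hd
  refine not_continuous_piSingle a hv ?_
  convert Continuous.sub h hG using 1
  ext1 x
  by_cases hx : x = a
  · subst hx
    simp
  · simp [hx]

/-- `C(X,ℝ^D)` is a closed and nowhere dense subset of the uniform closure of
the set of bounded functions admitting a representation ("the closure of the PCNNs"):
it is contained in that closure, closed in it, and the only open subset (in the subspace
topology) of that closure contained in `C(X,ℝ^D)` is empty. -/
theorem continuous_nowhere_dense_in_closure_PRep
    (d D : ℕ) (hd : 0 < d) (hD : 0 < D) :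
    ContFun d D ⊆ closure (PRep d D) ∧
    IsClosed {G : closure (PRep d D) | (G : BddFun d D) ∈ ContFun d D} ∧
    ∀ U : Set (closure (PRep d D)), IsOpen U →
      U ⊆ {G : closure (PRep d D) | (G : BddFun d D) ∈ ContFun d D} → U = ∅ := by
  classical
  refine ⟨(contFun_subset_PRep d D).trans subset_closure,
    (isClosed_contFun d D).preimage continuous_subtype_val, fun U hU hUC => ?_⟩
  rw [Set.eq_empty_iff_forall_notMem]
  intro G hGU
  have hG : (G : BddFun d D) ∈ ContFun d D := hUC hGU
  let v : EuclideanSpace ℝ (Fin D) := EuclideanSpace.single ⟨0, hD⟩ 1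
  have hv : v ≠ 0 := by simp [v]
  let γ : ℝ → closure (PRep d D) := fun c =>
    ⟨(G : BddFun d D) + lp.single ∞ (cubeZero d) (c • v),
      subset_closure (add_single_mem_PRep hG _ _)⟩
  have hγ : Continuous γ := by
    refine Continuous.subtype_mk ?_ _
    simp only [lp.single_smul]
    fun_prop
  have hγ0 : γ 0 = G := Subtype.ext (by simp [γ])
  have hev : ∀ᶠ c in 𝓝[≠] (0 : ℝ), γ c ∈ U :=
    (hγ.continuousAt.eventually_mem (hU.mem_nhds (hγ0.symm ▸ hGU))).filter_mono
      nhdsWithin_le_nhds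
  obtain ⟨c, hcU, hc⟩ := (hev.and self_mem_nhdsWithin).exists
  exact add_single_notMem_contFun hd hG (cubeZero d) (smul_ne_zero hc hv) (hUC hcU)
end

section
/- Let X ⊆ ℝ^d be nonempty and compact, let f ∈ B(X,ℝ^D) have finite minimal representation number N(f), and let ((f_n,K_n))_{n=1}^{N(f)} be a representation of f with exactly N(f) parts. Then for every tuple ((f̂_n,K̂_n))_{n=1}^{N(f)} with each f̂_n : X → ℝ^D continuous and each K̂_n ⊆ X nonempty compact, the following decoupled upper bound holds: D_PC(f | ∑_{n=1}^{N(f)} f̂_n·1_{K̂_n}) ≤ ∑_{n=1}^{N(f)} ‖f_n − f̂_n‖_∞ + ∑_{n=1}^{N(f)} d_H(K_n, K̂_n). -/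
open scoped ENNReal

/-- `IsRep X f fs Ks` : `((fs n, Ks n))_{n=1}^N` is a representation of `f` on `X`,
with `N` a positive integer, the `fs n` continuous on `X`, the `Ks n` nonempty compact
subsets of `X`, and `f = ∑ n, fs n · 1_{Ks n}` on `X`. -/
def IsRep {d D : ℕ} (X : Set (EuclideanSpace ℝ (Fin d)))
    (f : EuclideanSpace ℝ (Fin d) → EuclideanSpace ℝ (Fin D)) {N : ℕ}
    (fs : Fin N → EuclideanSpace ℝ (Fin d) → EuclideanSpace ℝ (Fin D))
    (Ks : Fin N → Set (EuclideanSpace ℝ (Fin d))) : Prop :=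
  0 < N ∧
    (∀ n, ContinuousOn (fs n) X) ∧
    (∀ n, (Ks n).Nonempty ∧ IsCompact (Ks n) ∧ Ks n ⊆ X) ∧
    ∀ x ∈ X, f x = ∑ n, (Ks n).indicator (fs n) x

/-- The piecewise divergence `D_PC(f|g)` (with minimal representation number `Nf` of `f`
given as a parameter): the infimum over all representations `F` of `f` and `G` of `g` of
`d_Step1(F,G) + |#F − Nf| + |#G − Nf|`, where `d_Step1` is the maximum over parts of the
maximum of the uniform distance between subpatterns and the Hausdorff distance between
parts, and is `∞` when `#F ≠ #G`. -/
noncomputable def DPC {d D : ℕ} (X : Set (EuclideanSpace ℝ (Fin d))) (Nf : ℕ)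
    (f g : EuclideanSpace ℝ (Fin d) → EuclideanSpace ℝ (Fin D)) : ℝ≥0∞ :=
  ⨅ (N : ℕ) (N' : ℕ)
    (fs : Fin N → EuclideanSpace ℝ (Fin d) → EuclideanSpace ℝ (Fin D))
    (Ks : Fin N → Set (EuclideanSpace ℝ (Fin d)))
    (gs : Fin N' → EuclideanSpace ℝ (Fin d) → EuclideanSpace ℝ (Fin D))
    (Ls : Fin N' → Set (EuclideanSpace ℝ (Fin d)))
    (_ : IsRep X f fs Ks) (_ : IsRep X g gs Ls),
    (if h : N = N' then
        ⨆ n : Fin N,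
          max (⨆ x ∈ X, edist (fs n x) (gs (Fin.cast h n) x))
            (EMetric.hausdorffEdist (Ks n) (Ls (Fin.cast h n)))
      else ⊤)
      + (((N : ℤ) - (Nf : ℤ)).natAbs : ℝ≥0∞)
      + (((N' : ℤ) - (Nf : ℤ)).natAbs : ℝ≥0∞)

/-- Representations of `f` and `g` with `Nf` parts each bound `DPC X Nf f g` by their
part-wise distance. -/
theorem DPC_le_of_isRep {d D Nf : ℕ} {X : Set (EuclideanSpace ℝ (Fin d))}
    {f g : EuclideanSpace ℝ (Fin d) → EuclideanSpace ℝ (Fin D)}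
    {fs gs : Fin Nf → EuclideanSpace ℝ (Fin d) → EuclideanSpace ℝ (Fin D)}
    {Ks Ls : Fin Nf → Set (EuclideanSpace ℝ (Fin d))}
    (hf : IsRep X f fs Ks) (hg : IsRep X g gs Ls) :
    DPC X Nf f g ≤ ⨆ n, max (⨆ x ∈ X, edist (fs n x) (gs n x))
      (EMetric.hausdorffEdist (Ks n) (Ls n)) := by
  refine iInf_le_of_le Nf <| iInf_le_of_le Nf <| iInf_le_of_le fs <| iInf_le_of_le Ks <|
    iInf_le_of_le gs <| iInf_le_of_le Ls <| iInf_le_of_le hf <| iInf_le_of_le hg ?_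
  simp

/-- Decoupled upper bound on the piecewise divergence. If `f` has minimal
representation number `Nf` witnessed by the representation `((fs n, Ks n))_{n<Nf}`, then
for any continuous `fhat n` and nonempty compact `Khat n ⊆ X`,
`D_PC(f | ∑ n, fhat n · 1_{Khat n})` is at most
`∑ n, ‖fs n − fhat n‖_∞ + ∑ n, d_H(Ks n, Khat n)`. -/
theorem DPC_decoupled_upper_bound
    {d D : ℕ} (X : Set (EuclideanSpace ℝ (Fin d))) (hXne : X.Nonempty) (hX : IsCompact X)
    (f : EuclideanSpace ℝ (Fin d) → EuclideanSpace ℝ (Fin D)) (Nf : ℕ)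
    (fs : Fin Nf → EuclideanSpace ℝ (Fin d) → EuclideanSpace ℝ (Fin D))
    (Ks : Fin Nf → Set (EuclideanSpace ℝ (Fin d)))
    (hrep : IsRep X f fs Ks)
    (hmin : ∀ (M : ℕ)
      (gs : Fin M → EuclideanSpace ℝ (Fin d) → EuclideanSpace ℝ (Fin D))
      (Ls : Fin M → Set (EuclideanSpace ℝ (Fin d))), IsRep X f gs Ls → Nf ≤ M)
    (fhat : Fin Nf → EuclideanSpace ℝ (Fin d) → EuclideanSpace ℝ (Fin D))
    (Khat : Fin Nf → Set (EuclideanSpace ℝ (Fin d)))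
    (hfhat : ∀ n, ContinuousOn (fhat n) X)
    (hKhat : ∀ n, (Khat n).Nonempty ∧ IsCompact (Khat n) ∧ Khat n ⊆ X) :
    DPC X Nf f (fun x => ∑ n, (Khat n).indicator (fhat n) x)
      ≤ ∑ n, (⨆ x ∈ X, edist (fs n x) (fhat n x))
        + ∑ n, EMetric.hausdorffEdist (Ks n) (Khat n) := by
  refine (DPC_le_of_isRep hrep ⟨hrep.1, hfhat, hKhat, fun _ _ => rfl⟩).trans ?_
  refine iSup_le fun n => max_le ?_ ?_
  · exact (Finset.single_le_sum_of_canonicallyOrdered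
      (f := fun n => ⨆ x ∈ X, edist (fs n x) (fhat n x)) (Finset.mem_univ n)).trans le_self_add
  · exact (Finset.single_le_sum_of_canonicallyOrdered
      (f := fun n => EMetric.hausdorffEdist (Ks n) (Khat n)) (Finset.mem_univ n)).trans
        le_add_self
end

section
/- Let X ⊆ ℝ^d be nonempty and compact, let K_1,…,K_N ⊆ X be nonempty compact sets, let ε > 0, and let ĉ : X → ℝ^N be a continuous function satisfying max_{1≤n≤N} sup_{x∈X} |ĉ(x)_n − dist(x,K_n)| ≤ ε/2, where dist(x,K) := inf_{y∈K} ‖x − y‖. Define K̂_n := {x ∈ X : ĉ(x)_n ≤ ε/2}. Then for each n = 1,…,N: K_n ⊆ K̂_n, the set K̂_n is nonempty and compact, and d_H(K_n, K̂_n) ≤ ε. -/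
/-- Key estimate for deep zero-sets. If `ĉ : X → ℝ^N` is continuous on the
nonempty compact `X ⊆ ℝ^d` and uniformly `ε/2`-approximates the distance functions
`x ↦ dist(x, K_n)` of nonempty compact sets `K_n ⊆ X`, then the sublevel sets
`K̂_n = {x ∈ X : ĉ(x)_n ≤ ε/2}` contain `K_n`, are nonempty and compact, and satisfy
`d_H(K_n, K̂_n) ≤ ε`. -/
theorem deep_zero_sets_key_estimate
    {d N : ℕ} (X : Set (EuclideanSpace ℝ (Fin d))) (hXne : X.Nonempty) (hX : IsCompact X)
    (K : Fin N → Set (EuclideanSpace ℝ (Fin d)))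
    (hKne : ∀ n, (K n).Nonempty) (hKc : ∀ n, IsCompact (K n)) (hKX : ∀ n, K n ⊆ X)
    (ε : ℝ) (hε : 0 < ε)
    (c : EuclideanSpace ℝ (Fin d) → EuclideanSpace ℝ (Fin N))
    (hc : ContinuousOn c X)
    (happrox : ∀ (n : Fin N), ∀ x ∈ X, |c x n - Metric.infDist x (K n)| ≤ ε / 2) :
    ∀ n : Fin N,
      K n ⊆ {x ∈ X | c x n ≤ ε / 2} ∧
      ({x ∈ X | c x n ≤ ε / 2}).Nonempty ∧
      IsCompact {x ∈ X | c x n ≤ ε / 2} ∧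
      Metric.hausdorffDist (K n) {x ∈ X | c x n ≤ ε / 2} ≤ ε := by
  intro n
  have hsub : K n ⊆ {x ∈ X | c x n ≤ ε / 2} := fun x hx => by
    have h := happrox n x (hKX n hx)
    rw [Metric.infDist_zero_of_mem hx, sub_zero] at h
    exact ⟨hKX n hx, (le_abs_self _).trans h⟩
  have hcn : ContinuousOn (fun x => c x n) X :=
    (EuclideanSpace.proj (𝕜 := ℝ) n).continuous.comp_continuousOn hc
  refine ⟨hsub, (hKne n).mono hsub, ?_, ?_⟩
  · exact hX.of_isClosed_subset
      (hcn.preimage_isClosed_of_isClosed hX.isClosed isClosed_Iic) (Set.sep_subset _ _)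
  · refine Metric.hausdorffDist_le_of_infDist hε.le (fun x hx => ?_) (fun x hx => ?_)
    · rw [Metric.infDist_zero_of_mem (hsub hx)]
      exact hε.le
    · have h := (abs_le.mp (happrox n x hx.1)).1
      linarith [hx.2]
end

section
/- Let X ⊆ ℝ^d be nonempty and compact, let K_1,…,K_N ⊆ X be nonempty compact sets, let ε > 0, and let E be a dense subset of C(X,ℝ^N), the continuous functions X → ℝ^N with the uniform norm. Then there exists ĉ ∈ E such that the sets K̂_n := {x ∈ X : ĉ(x)_n ≤ ε/2}, for n = 1,…,N, are nonempty compact sets containing K_n and satisfy simultaneously max_{1≤n≤N} d_H(K_n, K̂_n) ≤ ε. -/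
/-- Deep zero-sets are universal approximators of compact sets. If `E` is any
set of functions that is uniformly dense in the continuous functions `X → ℝ^N` on the
nonempty compact `X ⊆ ℝ^d`, then for any nonempty compact sets `K_1, …, K_N ⊆ X` and any
`ε > 0` there is `ĉ ∈ E` whose sublevel sets `K̂_n = {x ∈ X : ĉ(x)_n ≤ ε/2}` are nonempty
compact sets containing `K_n` with `max_n d_H(K_n, K̂_n) ≤ ε`. -/
theorem deep_zero_sets_universal
    {d N : ℕ} (X : Set (EuclideanSpace ℝ (Fin d))) (hXne : X.Nonempty) (hX : IsCompact X)
    (K : Fin N → Set (EuclideanSpace ℝ (Fin d)))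
    (hKne : ∀ n, (K n).Nonempty) (hKc : ∀ n, IsCompact (K n)) (hKX : ∀ n, K n ⊆ X)
    (ε : ℝ) (hε : 0 < ε)
    (E : Set (EuclideanSpace ℝ (Fin d) → EuclideanSpace ℝ (Fin N)))
    (hEc : ∀ c ∈ E, ContinuousOn c X)
    (hEdense : ∀ g : EuclideanSpace ℝ (Fin d) → EuclideanSpace ℝ (Fin N),
      ContinuousOn g X → ∀ δ : ℝ, 0 < δ → ∃ c ∈ E, ∀ x ∈ X, ‖c x - g x‖ < δ) :
    ∃ c ∈ E, ∀ n : Fin N,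
      K n ⊆ {x ∈ X | c x n ≤ ε / 2} ∧
      ({x ∈ X | c x n ≤ ε / 2}).Nonempty ∧
      IsCompact {x ∈ X | c x n ≤ ε / 2} ∧
      Metric.hausdorffDist (K n) {x ∈ X | c x n ≤ ε / 2} ≤ ε := by
  obtain ⟨c, hcE, hc⟩ := hEdense (fun x => WithLp.toLp 2 fun n => Metric.infDist x (K n))
    (Continuous.continuousOn (by
      refine (PiLp.continuous_toLp 2 _).comp (continuous_pi fun n => ?_)
      exact Metric.continuous_infDist_pt (K n))) (ε / 2) (half_pos hε)
  have h_coord : ∀ x ∈ X, ∀ n, |c x n - Metric.infDist x (K n)| < ε / 2 := fun x hx n =>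
    (PiLp.norm_apply_le (c x - WithLp.toLp 2 fun n => Metric.infDist x (K n)) n).trans_lt (hc x hx)
  refine ⟨c, hcE, fun n => ?_⟩
  have h_sub : K n ⊆ {x ∈ X | c x n ≤ ε / 2} := fun x hx => by
    have h := (abs_lt.mp (h_coord x (hKX n hx) n)).2
    rw [Metric.infDist_zero_of_mem hx] at h
    exact ⟨hKX n hx, by linarith⟩
  have h_cont : ContinuousOn (fun x => c x n) X :=
    (PiLp.continuous_apply 2 _ n).comp_continuousOn (hEc c hcE)
  refine ⟨h_sub, (hKne n).mono h_sub, ?_, Metric.hausdorffDist_le_of_infDist hε.le ?_ ?_⟩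
  · exact hX.of_isClosed_subset (h_cont.preimage_isClosed_of_isClosed hX.isClosed isClosed_Iic)
      fun x hx => hx.1
  · intro x hx
    rw [Metric.infDist_zero_of_mem (h_sub hx)]
    exact hε.le
  · intro x hx
    have h := (abs_lt.mp (h_coord x hx.1 n)).1
    have h_le : c x n ≤ ε / 2 := hx.2
    linarith
end

section
/- Let N be a positive integer, f_1,…,f_N : ℝ^d → ℝ^D continuous, L : ℝ^D → [0,∞) continuous, μ a Borel probability measure on ℝ^d, and δ ∈ (0,1]. Then there exist a compact set X_δ ⊆ ℝ^d and compact sets K_1^*,…,K_N^* ⊆ X_δ such that: (i) μ(X_δ) ≥ 1 − δ; (ii) the sets K_1^*,…,K_N^* are pairwise disjoint and their union equals X_δ; (iii) each K_n^* is open in the subspace topology of X_δ; and (iv) for every n and every x ∈ K_n^*, L(f_n(x)) = min_{1≤m≤N} L(f_m(x)). -/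
open MeasureTheory in
/-- Given a finite measurable cover, the members can be shrunk to compact sets whose union misses
at most `δ` of the total mass. -/
theorem exists_isCompact_subset_measure_compl_iUnion_le {X ι : Type*} [Fintype ι] [Nonempty ι]
    [TopologicalSpace X] [T2Space X] [MeasurableSpace X] [OpensMeasurableSpace X]
    (μ : Measure X) [IsFiniteMeasure μ] [μ.InnerRegularCompactLTTop]
    {B : ι → Set X} (hB : ∀ i, MeasurableSet (B i)) (hcover : ⋃ i, B i = Set.univ)
    {δ : ENNReal} (hδ : δ ≠ 0) :
    ∃ K : ι → Set X, (∀ i, K i ⊆ B i) ∧ (∀ i, IsCompact (K i)) ∧ μ (⋃ i, K i)ᶜ ≤ δ := by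
  have hε : δ / Fintype.card ι ≠ 0 := ENNReal.div_ne_zero.2 ⟨hδ, ENNReal.natCast_ne_top _⟩
  choose K hKB hKc hKμ using fun i =>
    (hB i).exists_isCompact_sdiff_lt (measure_ne_top μ (B i)) hε
  refine ⟨K, hKB, hKc, ?_⟩
  calc μ (⋃ i, K i)ᶜ ≤ μ (⋃ i, B i \ K i) := by
        refine measure_mono fun x hx => ?_
        obtain ⟨i, hi⟩ := Set.mem_iUnion.1 (hcover.symm ▸ Set.mem_univ x : x ∈ ⋃ i, B i)
        exact Set.mem_iUnion.2 ⟨i, hi, fun h => hx (Set.mem_iUnion.2 ⟨i, h⟩)⟩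
    _ ≤ ∑ i, μ (B i \ K i) := measure_iUnion_fintype_le _ _
    _ ≤ ∑ _i : ι, δ / Fintype.card ι := Finset.sum_le_sum fun i _ => (hKμ i).le
    _ = δ := by
        rw [Finset.sum_const, nsmul_eq_mul, Finset.card_univ]
        exact ENNReal.mul_div_cancel (by simp) (ENNReal.natCast_ne_top _)

/-- A function on a nonempty finite linear order has a least minimizer. -/
theorem exists_forall_le_and_forall_lt_lt {ι α : Type*} [LinearOrder ι] [Finite ι] [Nonempty ι]
    [LinearOrder α] (g : ι → α) : ∃ n, (∀ m, g n ≤ g m) ∧ ∀ m < n, g n < g m := by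
  obtain ⟨n, hn, hmin⟩ := ({n | ∀ m, g n ≤ g m} : Set ι).toFinite.exists_minimal
    (Finite.exists_min g)
  refine ⟨n, hn, fun m hm => lt_of_not_ge fun h => ?_⟩
  exact hm.not_ge (hmin (fun k => h.trans (hn k)) hm.le)


/-- Existence of a performance-optimizing partition. For continuous models
`f_1, …, f_N`, a continuous loss `L : ℝ^D → [0,∞)`, a Borel probability measure `μ` on
`ℝ^d`, and `δ ∈ (0,1]`, there are a compact set `X_δ` of `μ`-measure at least `1 - δ` and
pairwise disjoint compact sets `K_1^*, …, K_N^*` covering `X_δ`, each open in the subspace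
topology of `X_δ`, on each of which the `n`-th model is loss-minimizing. -/
theorem performance_optimizing_partition
    {d D N : ℕ} (hN : 0 < N)
    (f : Fin N → EuclideanSpace ℝ (Fin d) → EuclideanSpace ℝ (Fin D))
    (hf : ∀ n, Continuous (f n))
    (L : EuclideanSpace ℝ (Fin D) → ℝ) (hL : Continuous L) (hL0 : ∀ y, 0 ≤ L y)
    (μ : MeasureTheory.Measure (EuclideanSpace ℝ (Fin d)))
    [MeasureTheory.IsProbabilityMeasure μ]
    (δ : ℝ) (hδ0 : 0 < δ) (hδ1 : δ ≤ 1) :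
    ∃ (Xδ : Set (EuclideanSpace ℝ (Fin d))) (K : Fin N → Set (EuclideanSpace ℝ (Fin d))),
      IsCompact Xδ ∧
      ENNReal.ofReal (1 - δ) ≤ μ Xδ ∧
      (∀ n, IsCompact (K n) ∧ K n ⊆ Xδ) ∧
      (∀ n m, n ≠ m → K n ∩ K m = ∅) ∧
      (⋃ n, K n) = Xδ ∧
      (∀ n, ∃ U : Set (EuclideanSpace ℝ (Fin d)), IsOpen U ∧ K n = U ∩ Xδ) ∧
      (∀ n, ∀ x ∈ K n, L (f n x) = ⨅ m : Fin N, L (f m x)) := by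
  have : Nonempty (Fin N) := ⟨⟨0, hN⟩⟩
  let g : Fin N → EuclideanSpace ℝ (Fin d) → ℝ := fun n x => L (f n x)
  have hg : ∀ n, Continuous (g n) := fun n => hL.comp (hf n)
  let B : Fin N → Set (EuclideanSpace ℝ (Fin d)) :=
    fun n => {x | (∀ m, g n x ≤ g m x) ∧ ∀ m < n, g n x < g m x}
  have hB : ∀ n, MeasurableSet (B n) := fun n => by
    refine MeasurableSet.inter (s₁ := {x | ∀ m, g n x ≤ g m x})
      (s₂ := {x | ∀ m < n, g n x < g m x}) ?_ ?_
    · rw [Set.ofPred_forall]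
      exact MeasurableSet.iInter fun m => measurableSet_le (hg n).measurable (hg m).measurable
    · simp only [Set.ofPred_forall]
      exact MeasurableSet.iInter fun m => MeasurableSet.iInter fun _ =>
        measurableSet_lt (hg n).measurable (hg m).measurable
  have hcover : ⋃ n, B n = Set.univ := Set.eq_univ_of_forall fun x =>
    Set.mem_iUnion.2 (exists_forall_le_and_forall_lt_lt fun n => g n x)
  obtain ⟨K, hKB, hKc, hKμ⟩ := exists_isCompact_subset_measure_compl_iUnion_le μ hB hcover
    (δ := ENNReal.ofReal δ) (by simpa using hδ0)
  have hunique : ∀ n m x, x ∈ K n → x ∈ K m → n = m := fun n m x hn hm => by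
    rcases lt_trichotomy n m with h | h | h
    · exact absurd ((hKB n hn).1 m) ((hKB m hm).2 n h).not_ge
    · exact h
    · exact absurd ((hKB m hm).1 n) ((hKB n hn).2 m h).not_ge
  have hX : IsCompact (⋃ n, K n) := isCompact_iUnion hKc
  refine ⟨⋃ n, K n, K, hX, ?_, fun n => ⟨hKc n, Set.subset_iUnion K n⟩, ?_, rfl, ?_, ?_⟩
  · rw [ENNReal.ofReal_sub _ hδ0.le, ENNReal.ofReal_one, tsub_le_iff_right,
      ← MeasureTheory.prob_add_prob_compl (μ := μ) hX.measurableSet]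
    gcongr
  · intro n m hnm
    exact Set.eq_empty_of_forall_notMem fun x hx => hnm (hunique n m x hx.1 hx.2)
  · intro n
    refine ⟨(⋃ m : {m // m ≠ n}, K m)ᶜ,
      (isCompact_iUnion fun m : {m // m ≠ n} => hKc m).isClosed.isOpen_compl, ?_⟩
    ext x
    simp only [Set.mem_inter_iff, Set.mem_compl_iff, Set.mem_iUnion, Subtype.exists, not_exists]
    constructor
    · exact fun hx => ⟨fun m hm hxm => hm (hunique m n x hxm hx), n, hx⟩
    · rintro ⟨hx, m, hxm⟩
      by_cases h : m = n
      · exact h ▸ hxm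
      · exact absurd hxm (hx m h)
  · intro n x hx
    exact le_antisymm (le_ciInf (hKB n hx).1) (ciInf_le (Set.finite_range _).bddBelow n)
end
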